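/- arXiv:2208.09854 — 2 statements merged into one kernel-verified Lean document; each statement's English description precedes it below -/
import Mathlib

section
/- Let 𝓘 be an infinite independent family of subsets of ω. Then for every X ⊆ ω, X ∈ id(𝓘) if and only if for every g' ∈ FF(𝓘) there is g ∈ FF(𝓘) with g ⊇ g' and 𝓘^g ∩ X = ∅. In other words, for infinite independent families the meaning of the density ideal is unchanged if 'finite' is replaced by 'empty'. -/
open Set

/-- Finite partial functions from `I` to `{0,1}`, coded as functions
`Set ℕ → Option Bool` with finite support contained in `I`. -/
def FF (I : Set (Set ℕ)) : Set (Set ℕ → Option Bool) :=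
  {g | (∀ A, g A ≠ none → A ∈ I) ∧ {A | g A ≠ none}.Finite}

/-- The Boolean combination `𝓘^g`: intersection of all `A` with `g A = 1`
and all `ω ∖ A` with `g A = 0` (equal to `ω` when `g` is empty). -/
def BoolComb (g : Set ℕ → Option Bool) : Set ℕ :=
  {n | ∀ A : Set ℕ, (g A = some true → n ∈ A) ∧ (g A = some false → n ∉ A)}

/-- `g` extends `g'` as a partial function. -/
def Extends (g g' : Set ℕ → Option Bool) : Prop :=
  ∀ A b, g' A = some b → g A = some b

/-- `I` is an independent family. -/
def Indep (I : Set (Set ℕ)) : Prop :=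
  ∀ g ∈ FF I, (BoolComb g).Infinite

/-- The density filter `fil(𝓘)`. -/
def densityFilter (I : Set (Set ℕ)) : Set (Set ℕ) :=
  {X | ∀ g' ∈ FF I, ∃ g ∈ FF I, Extends g g' ∧ (BoolComb g \ X).Finite}

/-- The density ideal `id(𝓘)`. -/
def densityIdeal (I : Set (Set ℕ)) : Set (Set ℕ) :=
  {X | ∀ g' ∈ FF I, ∃ g ∈ FF I, Extends g g' ∧ (BoolComb g ∩ X).Finite}

/-- `I` is densely maximal. -/
def DenselyMaximal (I : Set (Set ℕ)) : Prop :=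
  ∀ X : Set ℕ, X.Infinite → ∀ g' ∈ FF I, ∃ g ∈ FF I, Extends g g' ∧
    ((BoolComb g ∩ X).Finite ∨ (BoolComb g \ X).Finite)

theorem Extends.trans {g₁ g₂ g₃ : Set ℕ → Option Bool} (h : Extends g₁ g₂)
    (h' : Extends g₂ g₃) : Extends g₁ g₃ :=
  fun A b hA => h A b (h' A b hA)

theorem Extends.boolComb_subset {g g' : Set ℕ → Option Bool} (h : Extends g g') :
    BoolComb g ⊆ BoolComb g' :=
  fun _ hn A => ⟨fun hA => (hn A).1 (h A _ hA), fun hA => (hn A).2 (h A _ hA)⟩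

/-- If `I` is infinite, every `g ∈ FF I` has an extension whose Boolean combination omits a
given point. -/
theorem exists_extends_notMem_boolComb {I : Set (Set ℕ)} (hinf : I.Infinite)
    {g : Set ℕ → Option Bool} (hg : g ∈ FF I) (n : ℕ) :
    ∃ h ∈ FF I, Extends h g ∧ n ∉ BoolComb h := by
  classical
  obtain ⟨A, hAI, hA⟩ := hinf.exists_notMem_finite hg.2
  have hgA : g A = none := by simpa using hA
  refine ⟨Function.update g A (some (decide (n ∉ A))), ⟨fun B hB => ?_, ?_⟩, fun B b hB => ?_,
    fun hn => ?_⟩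
  · by_cases hBA : B = A
    · exact hBA ▸ hAI
    · exact hg.1 B (by simpa [Function.update_of_ne hBA] using hB)
  · refine (hg.2.insert A).subset fun B hB => ?_
    by_cases hBA : B = A
    · exact Or.inl hBA
    · exact Or.inr (by simpa [Function.update_of_ne hBA] using hB)
  · have hBA : B ≠ A := by
      rintro rfl
      simp [hgA] at hB
    rwa [Function.update_of_ne hBA]
  · have hnA := hn A
    by_cases h : n ∈ A <;> simp [h] at hnA

/-- If `I` is infinite, every `g ∈ FF I` has an extension whose Boolean combination is disjoint
from a given finite set. -/
theorem exists_extends_boolComb_inter_eq_empty {I : Set (Set ℕ)} (hinf : I.Infinite)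
    {F : Set ℕ} (hF : F.Finite) {g : Set ℕ → Option Bool} (hg : g ∈ FF I) :
    ∃ h ∈ FF I, Extends h g ∧ BoolComb h ∩ F = ∅ := by
  induction F, hF using Set.Finite.induction_on with
  | empty => exact ⟨g, hg, fun _ _ h => h, inter_empty _⟩
  | @insert n F _ _ ih =>
    obtain ⟨h, hh, hhg, hF⟩ := ih
    obtain ⟨k, hk, hkh, hn⟩ := exists_extends_notMem_boolComb hinf hh n
    refine ⟨k, hk, hkh.trans hhg, ?_⟩
    rw [inter_insert_of_notMem hn]
    exact subset_empty_iff.1 (hF ▸ inter_subset_inter_left F hkh.boolComb_subset)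

theorem stmt4 (I : Set (Set ℕ)) (hI : Indep I) (hinf : I.Infinite) :
    ∀ X : Set ℕ, X ∈ densityIdeal I ↔
      ∀ g' ∈ FF I, ∃ g ∈ FF I, Extends g g' ∧ BoolComb g ∩ X = ∅ := by
  refine fun X => ⟨fun hX g' hg' => ?_, fun hX g' hg' => ?_⟩
  · obtain ⟨g, hg, hgg', hfin⟩ := hX g' hg'
    obtain ⟨h, hh, hhg, hempty⟩ := exists_extends_boolComb_inter_eq_empty hinf hfin hg
    refine ⟨h, hh, hhg.trans hgg', ?_⟩
    rwa [← inter_assoc, inter_eq_left.2 hhg.boolComb_subset] at hempty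
  · obtain ⟨g, hg, hgg', hempty⟩ := hX g' hg'
    exact ⟨g, hg, hgg', hempty ▸ finite_empty⟩
end

section
/- Let 𝓕 be a filter on ω containing all cofinite sets, all of whose elements are infinite, and assume 𝓕 is a Q-set. Then for every strictly increasing function f : ω → ω and every C ∈ 𝓕 there is C* ∈ 𝓕 with C* ⊆ C such that, letting {k_n : n < ω} be the strictly increasing enumeration of C*, f(k_n) < k_{n+1} holds for all n < ω and moreover f(1) < k_1. -/
open Set

/-- `F` is a Q-set: every partition of `ω` into finite sets admits a
semiselector in `F`. -/
def QSet (F : Set (Set ℕ)) : Prop :=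
  ∀ p : ℕ → Set ℕ, (∀ n, (p n).Finite) →
    Pairwise (Function.onFun Disjoint p) → (⋃ n, p n) = Set.univ →
    ∃ A ∈ F, ∀ n, (A ∩ p n).Subsingleton

/-- A Q-set contains a set on which a given finite-to-one function is injective. -/
theorem QSet.exists_injOn {F : Set (Set ℕ)} (hQ : QSet F) (h : ℕ → ℕ)
    (hfin : ∀ n, (h ⁻¹' {n}).Finite) : ∃ A ∈ F, InjOn h A := by
  obtain ⟨A, hA, hsub⟩ := hQ (fun n => h ⁻¹' {n}) hfin
    (fun m n hmn => Disjoint.preimage h (disjoint_singleton.2 hmn))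
    (by ext x; simp)
  exact ⟨A, hA, fun x hx y hy hxy => hsub (h y) ⟨hx, hxy⟩ ⟨hy, rfl⟩⟩

/-- A strictly increasing sequence starting at `0` cuts `ℕ` into consecutive intervals. -/
theorem StrictMono.exists_le_and_lt_succ {a : ℕ → ℕ} (ha : StrictMono a) (h0 : a 0 = 0)
    (x : ℕ) : ∃ i, a i ≤ x ∧ x < a (i + 1) := by
  have hex : ∃ n, x < a n := ⟨x + 1, (Nat.lt_succ_self x).trans_le ha.le_apply⟩
  obtain ⟨i, hi⟩ : ∃ i, Nat.find hex = i + 1 := Nat.exists_eq_succ_of_ne_zero fun h => by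
    have := Nat.find_spec hex
    rw [h] at this
    omega
  refine ⟨i, not_lt.1 (Nat.find_min hex (by omega)), ?_⟩
  rw [← hi]
  exact Nat.find_spec hex

/-- A Q-set closed under intersections contains a set whose elements grow faster than `f`. -/
theorem QSet.exists_forall_lt {F : Set (Set ℕ)} (hQ : QSet F)
    (hinter : ∀ X ∈ F, ∀ Y ∈ F, X ∩ Y ∈ F) {f : ℕ → ℕ} (hf : StrictMono f) :
    ∃ A ∈ F, ∀ x ∈ A, ∀ y ∈ A, x < y → f x < y := by
  let a : ℕ → ℕ := fun n => (fun x => f x + 1)^[n] 0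
  have hsucc (n : ℕ) : a (n + 1) = f (a n) + 1 := Function.iterate_succ_apply' _ _ _
  have ha : StrictMono a := strictMono_nat_of_lt_succ fun n => by
    rw [hsucc]
    exact Nat.lt_succ_of_le hf.le_apply
  choose idx hle hlt using ha.exists_le_and_lt_succ rfl
  have hfin (h : ℕ → ℕ) (hh : ∀ i, i ≤ 2 * h i + 1) (n : ℕ) :
      ((fun x => h (idx x)) ⁻¹' {n}).Finite := by
    refine (finite_Iio (a (2 * n + 2))).subset fun x hx => (hlt x).trans_le (ha.monotone ?_)
    have hx' : h (idx x) = n := hx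
    have := hh (idx x)
    omega
  obtain ⟨A, hA, hAinj⟩ := hQ.exists_injOn _ (hfin (fun i => i / 2) fun i => by omega)
  obtain ⟨B, hB, hBinj⟩ := hQ.exists_injOn _ (hfin (fun i => (i + 1) / 2) fun i => by omega)
  refine ⟨A ∩ B, hinter A hA B hB, fun x hx y hy hxy => ?_⟩
  have h1 : idx x / 2 ≠ idx y / 2 := fun h => hxy.ne (hAinj hx.1 hy.1 h)
  have h2 : (idx x + 1) / 2 ≠ (idx y + 1) / 2 := fun h => hxy.ne (hBinj hx.2 hy.2 h)
  have h3 : idx x < idx y + 1 := ha.lt_iff_lt.1 ((hle x).trans_lt (hxy.trans (hlt y)))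
  calc f x < f (a (idx x + 1)) := hf (hlt x)
    _ < a (idx x + 2) := (Nat.lt_succ_self _).trans_eq (hsucc _).symm
    _ ≤ a (idx y) := ha.monotone (by omega)
    _ ≤ y := hle y

theorem stmt9 (F : Set (Set ℕ))
    (hup : ∀ X ∈ F, ∀ Y : Set ℕ, X ⊆ Y → Y ∈ F)
    (hinter : ∀ X ∈ F, ∀ Y ∈ F, X ∩ Y ∈ F)
    (hcofin : ∀ X : Set ℕ, Xᶜ.Finite → X ∈ F)
    (hinf : ∀ X ∈ F, X.Infinite)
    (hQ : QSet F)
    (f : ℕ → ℕ) (hf : StrictMono f) (C : Set ℕ) (hC : C ∈ F) :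
    ∃ Cstar ∈ F, Cstar ⊆ C ∧
      (∀ n : ℕ, f (Nat.nth (· ∈ Cstar) n) < Nat.nth (· ∈ Cstar) (n + 1)) ∧
      f 1 < Nat.nth (· ∈ Cstar) 1 := by
  obtain ⟨A, hA, hgrow⟩ := hQ.exists_forall_lt hinter hf
  have hI : Ioi (f 1) ∈ F := hcofin _ (by rw [compl_Ioi]; exact finite_Iic _)
  have hS : C ∩ (A ∩ Ioi (f 1)) ∈ F := hinter _ hC _ (hinter _ hA _ hI)
  have hSinf := hinf _ hS
  have hmem (n : ℕ) := Nat.nth_mem_of_infinite hSinf n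
  exact ⟨_, hS, inter_subset_left,
    fun n => hgrow _ (hmem n).2.1 _ (hmem (n + 1)).2.1
      (Nat.nth_strictMono hSinf (Nat.lt_succ_self n)),
    (hmem 1).2.2⟩
end
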